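/- arXiv:2103.01870 — 2 statements merged into one kernel-verified Lean document; each statement's English description precedes it below -/
import Mathlib

section
/- For every integer n ≥ 1 and every function p : ℕ → [0,1], Σ_{m=0}^{n} C(n,m)·2^{−n}·p(m) ≤ 2 · Σ_{m=0}^{∞} e^{−n/2}·(n/2)^m/m! · p(m). Equivalently, for any [0,1]-valued observable of the number of points, its expectation under the Binomial(n,1/2) distribution is at most twice its expectation under the Poisson(n/2) distribution. -/
open MeasureTheory Set
open scoped ENNReal

/-- Comparison of factorials with their Stirling approximations, relative to each other. -/
lemma factorial_mul_stirling_le {k n : ℕ} (hk : 1 ≤ k) (hkn : k ≤ n) :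
    (n.factorial : ℝ) * (√k * k ^ k * Real.exp n) ≤
      k.factorial * (√n * n ^ n * Real.exp k) := by
  obtain ⟨a, rfl⟩ : ∃ a, k = a + 1 := ⟨k - 1, by omega⟩
  obtain ⟨b, rfl⟩ : ∃ b, n = b + 1 := ⟨n - 1, by omega⟩
  have h : Stirling.stirlingSeq (b + 1) ≤ Stirling.stirlingSeq (a + 1) :=
    Stirling.stirlingSeq'_antitone (by omega : a ≤ b)
  unfold Stirling.stirlingSeq at h
  rw [div_le_div_iff₀ (by positivity) (by positivity)] at h
  have hexp (m : ℕ) : Real.exp 1 ^ m = Real.exp m := by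
    rw [← Real.exp_nat_mul, mul_one]
  rw [Real.sqrt_mul (by norm_num), Real.sqrt_mul (by norm_num), div_pow, div_pow,
    hexp, hexp] at h
  have h2 : 0 < √(2 : ℝ) := by positivity
  have ha := Real.exp_pos ((a + 1 : ℕ) : ℝ)
  have hb := Real.exp_pos ((b + 1 : ℕ) : ℝ)
  field_simp at h
  linarith

lemma half_pow_le_pow_mul_exp {k : ℕ} (hk : 1 ≤ k) (n : ℕ) :
    ((n : ℝ) / 2) ^ k ≤ k ^ k * Real.exp (n / 2 - k) := by
  have hk0 : (0 : ℝ) < k := by exact_mod_cast hk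
  have h : (n : ℝ) / 2 ≤ k * Real.exp (n / 2 / k - 1) := by
    have := Real.add_one_le_exp ((n : ℝ) / 2 / k - 1)
    rw [sub_add_cancel, div_le_iff₀ hk0] at this
    linarith
  calc ((n : ℝ) / 2) ^ k ≤ (k * Real.exp (n / 2 / k - 1)) ^ k := by gcongr
    _ = k ^ k * Real.exp (n / 2 - k) := by
      rw [mul_pow, ← Real.exp_nat_mul]
      congr 2
      field_simp

lemma factorial_mul_exp_half_mul_pow_le_of_le_four_mul {k n : ℕ} (hk : 1 ≤ k) (hkn : k ≤ n)
    (h4 : n ≤ 4 * k) :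
    (n.factorial : ℝ) * Real.exp (n / 2) * (n / 2) ^ k ≤ 2 * k.factorial * n ^ n := by
  have hk0 : (0 : ℝ) < k := by exact_mod_cast hk
  have hsqrt : √(n : ℝ) ≤ 2 * √(k : ℝ) := by
    rw [Real.sqrt_le_left (by positivity), mul_pow, Real.sq_sqrt hk0.le]
    norm_num
    exact_mod_cast h4
  have hexp : Real.exp (n / 2) * Real.exp (n / 2 - k) * Real.exp k = Real.exp n := by
    rw [← Real.exp_add, ← Real.exp_add]
    ring_nf
  refine le_of_mul_le_mul_right ?_ (by positivity : 0 < √(k : ℝ) * Real.exp k)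
  calc (n.factorial : ℝ) * Real.exp (n / 2) * (n / 2) ^ k * (√k * Real.exp k)
      ≤ n.factorial * Real.exp (n / 2) * (k ^ k * Real.exp (n / 2 - k)) * (√k * Real.exp k) := by
        gcongr
        exact half_pow_le_pow_mul_exp hk n
    _ = n.factorial * (√k * k ^ k * Real.exp n) := by rw [← hexp]; ring
    _ ≤ k.factorial * (√n * n ^ n * Real.exp k) := factorial_mul_stirling_le hk hkn
    _ ≤ k.factorial * (2 * √k * n ^ n * Real.exp k) := by gcongr
    _ = 2 * k.factorial * n ^ n * (√k * Real.exp k) := by ring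

lemma factorial_mul_exp_half_mul_pow_le {k n : ℕ} (hn : 2 ≤ n) (hkn : k ≤ n) :
    (n.factorial : ℝ) * Real.exp (n / 2) * (n / 2) ^ k ≤ 2 * k.factorial * n ^ n := by
  induction hkn using Nat.decreasingInduction with
  | self => exact factorial_mul_exp_half_mul_pow_le_of_le_four_mul (by omega) le_rfl (by omega)
  | of_succ k hk ih =>
    by_cases h4 : n ≤ 4 * k
    · exact factorial_mul_exp_half_mul_pow_le_of_le_four_mul (by omega) hk.le h4
    have hstep : (k : ℝ) + 1 ≤ n / 2 := by
      rw [le_div_iff₀ (by norm_num)]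
      exact_mod_cast (by omega : (k + 1) * 2 ≤ n)
    have hk1 : (0 : ℝ) < k + 1 := by positivity
    refine le_of_mul_le_mul_right ?_ hk1
    calc (n.factorial : ℝ) * Real.exp (n / 2) * (n / 2) ^ k * (k + 1)
        ≤ n.factorial * Real.exp (n / 2) * (n / 2) ^ k * (n / 2) := by gcongr
      _ = n.factorial * Real.exp (n / 2) * (n / 2) ^ (k + 1) := by ring
      _ ≤ 2 * (k + 1).factorial * n ^ n := ih
      _ = 2 * k.factorial * n ^ n * (k + 1) := by
        rw [Nat.factorial_succ]
        push_cast
        ring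

lemma exp_half_le_two : Real.exp (1 / 2) ≤ 2 := by
  have h : Real.exp (1 / 2) * Real.exp (1 / 2) = Real.exp 1 := by
    rw [← Real.exp_add, add_halves]
  nlinarith [Real.exp_one_lt_d9, Real.exp_pos (1 / 2)]

/-- The Binomial(`n`, 1/2) mass function is at most twice the Poisson(`n`/2) one. -/
lemma choose_div_two_pow_le_two_mul_poisson {n m : ℕ} (hn : 1 ≤ n) (hm : m ≤ n) :
    (n.choose m : ℝ) / 2 ^ n ≤
      2 * (Real.exp (-(n : ℝ) / 2) * ((n : ℝ) / 2) ^ m / (m.factorial : ℝ)) := by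
  obtain ⟨k, rfl⟩ := Nat.exists_eq_add_of_le hm
  have key : ((m + k).factorial : ℝ) * Real.exp ((m + k : ℕ) / 2) * ((m + k : ℕ) / 2) ^ k ≤
      2 * k.factorial * (m + k : ℕ) ^ (m + k) := by
    rcases hn.lt_or_eq with h | h
    · exact factorial_mul_exp_half_mul_pow_le h (by omega)
    · rw [← h]
      obtain rfl | rfl : k = 0 ∨ k = 1 := by omega
      all_goals norm_num
      all_goals linarith [exp_half_le_two]
  have hN : (0 : ℝ) < (m + k : ℕ) := by exact_mod_cast hn
  rw [Nat.cast_choose ℝ hm, Nat.add_sub_cancel_left, neg_div, Real.exp_neg]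
  generalize ((m + k : ℕ) : ℝ) = N at *
  have hE := Real.exp_pos (N / 2)
  rw [div_pow] at key ⊢
  rw [pow_add] at key ⊢
  field_simp at key ⊢
  linarith

/-- For `n ≥ 1` and any `[0,1]`-valued `p : ℕ → ℝ`, the expectation of `p`
under `Binomial(n, 1/2)` is at most twice its expectation under `Poisson(n/2)`. -/
theorem binomial_expectation_le_two_poisson (n : ℕ) (hn : 1 ≤ n) (p : ℕ → ℝ)
    (hp : ∀ m, p m ∈ Icc (0 : ℝ) 1) :
    ∑ m ∈ Finset.range (n + 1), (n.choose m : ℝ) / 2 ^ n * p m ≤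
      2 * ∑' m : ℕ, Real.exp (-(n : ℝ) / 2) * ((n : ℝ) / 2) ^ m / (m.factorial : ℝ) * p m := by
  have hnonneg (m : ℕ) :
      0 ≤ Real.exp (-(n : ℝ) / 2) * ((n : ℝ) / 2) ^ m / (m.factorial : ℝ) := by positivity
  have hsum : Summable fun m : ℕ ↦
      Real.exp (-(n : ℝ) / 2) * ((n : ℝ) / 2) ^ m / (m.factorial : ℝ) * p m := by
    refine .of_nonneg_of_le (fun m ↦ mul_nonneg (hnonneg m) (hp m).1)
      (fun m ↦ mul_le_of_le_one_right (hnonneg m) (hp m).2) ?_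
    simpa only [mul_div_assoc] using
      (Real.summable_pow_div_factorial ((n : ℝ) / 2)).mul_left (Real.exp (-(n : ℝ) / 2))
  calc ∑ m ∈ Finset.range (n + 1), (n.choose m : ℝ) / 2 ^ n * p m
      ≤ ∑ m ∈ Finset.range (n + 1),
          2 * (Real.exp (-(n : ℝ) / 2) * ((n : ℝ) / 2) ^ m / (m.factorial : ℝ) * p m) := by
        refine Finset.sum_le_sum fun m hm ↦ ?_
        rw [← mul_assoc]
        exact mul_le_mul_of_nonneg_right
          (choose_div_two_pow_le_two_mul_poisson hn (Finset.mem_range_succ_iff.1 hm)) (hp m).1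
    _ = 2 * ∑ m ∈ Finset.range (n + 1),
          Real.exp (-(n : ℝ) / 2) * ((n : ℝ) / 2) ^ m / (m.factorial : ℝ) * p m := by
        rw [Finset.mul_sum]
    _ ≤ _ := by
        gcongr
        exact hsum.sum_le_tsum _ fun m _ ↦ mul_nonneg (hnonneg m) (hp m).1
end

section
/- Let n ≥ 1 be an integer and p : ℕ → [0,1] a function, and set q := Σ_{m=0}^{∞} e^{−n/2}·(n/2)^m/m! · p(m). If q > 0 and n ≥ 36/q, then Σ_{m=0}^{n} C(n,m)·2^{−n}·p(m) ≥ (q/4)·e^{−3/q}. -/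
open MeasureTheory Set
open scoped ENNReal


/-- A Stirling-type upper bound for the factorial. -/
theorem Nat.factorial_le_exp_one_mul_sqrt_mul_pow {k : ℕ} (hk : 1 ≤ k) :
    (k.factorial : ℝ) ≤ Real.exp 1 * √k * (k / Real.exp 1) ^ k := by
  obtain ⟨j, rfl⟩ : ∃ j, k = j + 1 := ⟨k - 1, by omega⟩
  have h : Stirling.stirlingSeq (j + 1) ≤ Stirling.stirlingSeq 1 :=
    Stirling.stirlingSeq'_antitone (Nat.zero_le j)
  rw [Stirling.stirlingSeq_one, Stirling.stirlingSeq, div_le_iff₀ (by positivity)] at h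
  refine h.trans_eq ?_
  rw [Real.sqrt_mul zero_le_two]
  field_simp

theorem two_mul_div_pow_le_exp (k : ℕ) {x : ℝ} (hx : 0 < x) :
    (2 * k / x) ^ k ≤ Real.exp (2 * (x / 2 - k) ^ 2 / x - x / 2 + k) := by
  have h : 2 * k / x ≤ Real.exp (2 * k / x - 1) := by
    linarith [Real.add_one_le_exp (2 * k / x - 1)]
  refine (pow_le_pow_left₀ (by positivity) h k).trans_eq ?_
  rw [← Real.exp_nat_mul]
  congr 1
  field_simp
  ring

/-- The factorial inequality behind the comparison of binomial and Poisson weights. -/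
theorem exp_mul_factorial_le_factorial_add (m : ℕ) {k : ℕ} (hk : 1 ≤ k) {x : ℝ}
    (hx : x = m + k) :
    1 / 2 * Real.exp (-(2 * (x / 2 - k) ^ 2 / x)) *
      (Real.exp (-x / 2) * (x / 2) ^ m * 2 ^ (m + k)) * k.factorial ≤ (m + k).factorial := by
  have hk' : (1 : ℝ) ≤ k := by exact_mod_cast hk
  have hm' : (0 : ℝ) ≤ m := m.cast_nonneg
  have hx0 : 0 < x := by linarith
  have hs : 1 / 2 * (Real.exp 1 * √k) ≤ √(2 * Real.pi * x) := by
    apply Real.le_sqrt_of_sq_le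
    have he : Real.exp 1 ^ 2 ≤ 3 ^ 2 :=
      pow_le_pow_left₀ (Real.exp_pos 1).le Real.exp_one_lt_three.le 2
    calc (1 / 2 * (Real.exp 1 * √k)) ^ 2 = 1 / 4 * (Real.exp 1 ^ 2 * k) := by
          rw [mul_pow, mul_pow, Real.sq_sqrt (by linarith)]; ring
      _ ≤ 1 / 4 * (3 ^ 2 * x) := by gcongr; linarith
      _ ≤ 2 * Real.pi * x := by nlinarith [Real.pi_gt_three]
  have hpow : Real.exp (-(2 * (x / 2 - k) ^ 2 / x)) *
      (Real.exp (-x / 2) * (x / 2) ^ m * 2 ^ (m + k)) * (k / Real.exp 1) ^ k ≤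
        (x / Real.exp 1) ^ (m + k) := by
    calc _ = x ^ (m + k) * (2 * k / x) ^ k *
          (Real.exp (-(2 * (x / 2 - k) ^ 2 / x)) * Real.exp (-x / 2) * Real.exp (-k)) := by
          rw [Real.exp_neg (k : ℝ), ← Real.exp_one_pow k]
          simp only [div_pow, mul_pow, pow_add]
          field_simp
      _ ≤ x ^ (m + k) * Real.exp (2 * (x / 2 - k) ^ 2 / x - x / 2 + k) *
          (Real.exp (-(2 * (x / 2 - k) ^ 2 / x)) * Real.exp (-x / 2) * Real.exp (-k)) := by
          gcongr
          exact two_mul_div_pow_le_exp k hx0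
      _ = x ^ (m + k) * Real.exp (-x) := by
          rw [mul_assoc]
          simp only [← Real.exp_add]
          ring_nf
      _ = (x / Real.exp 1) ^ (m + k) := by
          rw [div_pow, Real.exp_one_pow, Real.exp_neg, hx]
          push_cast
          rfl
  calc _ ≤ 1 / 2 * Real.exp (-(2 * (x / 2 - k) ^ 2 / x)) *
          (Real.exp (-x / 2) * (x / 2) ^ m * 2 ^ (m + k)) *
          (Real.exp 1 * √k * (k / Real.exp 1) ^ k) := by
        gcongr
        exact Nat.factorial_le_exp_one_mul_sqrt_mul_pow hk
    _ = 1 / 2 * (Real.exp 1 * √k) * (Real.exp (-(2 * (x / 2 - k) ^ 2 / x)) *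
          (Real.exp (-x / 2) * (x / 2) ^ m * 2 ^ (m + k)) * (k / Real.exp 1) ^ k) := by ring
    _ ≤ √(2 * Real.pi * x) * (x / Real.exp 1) ^ (m + k) := by gcongr
    _ ≤ (m + k).factorial := by
        have h := Stirling.le_factorial_stirling (m + k)
        push_cast at h
        rwa [hx]

/-- Up to a Gaussian factor, binomial weights dominate Poisson weights of the same mean. -/
theorem poisson_le_choose_div_two_pow {n m : ℕ} (h : m < n) :
    1 / 2 * Real.exp (-(2 * ((m : ℝ) - n / 2) ^ 2 / n)) *
      (Real.exp (-(n : ℝ) / 2) * ((n : ℝ) / 2) ^ m / (m.factorial : ℝ)) ≤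
        (n.choose m : ℝ) / 2 ^ n := by
  obtain ⟨k, rfl⟩ := Nat.exists_eq_add_of_lt h
  have key := exp_mul_factorial_le_factorial_add m (Nat.le_add_left 1 k)
    (x := ((m + k + 1 : ℕ) : ℝ)) (by push_cast; ring)
  have hsq : (((m + k + 1 : ℕ) : ℝ) / 2 - ((k + 1 : ℕ) : ℝ)) ^ 2 =
      ((m : ℝ) - ((m + k + 1 : ℕ) : ℝ) / 2) ^ 2 := by push_cast; ring
  have hc : (((m + k + 1).choose m : ℕ) : ℝ) * m.factorial * (k + 1).factorial =
      (m + k + 1).factorial := by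
    have := Nat.choose_mul_factorial_mul_factorial h.le
    rw [show m + k + 1 - m = k + 1 by omega] at this
    exact_mod_cast this
  rw [hsq, ← add_assoc, ← hc] at key
  rw [le_div_iff₀ (by positivity), ← mul_div_assoc, div_mul_eq_mul_div,
    div_le_iff₀ (by positivity)]
  refine le_of_mul_le_mul_right ?_ (Nat.cast_pos.2 (k + 1).factorial_pos : (0 : ℝ) < _)
  linarith

/-- The variance of the Poisson distribution equals its mean. -/
theorem hasSum_poisson_mul_sub_sq (r : ℝ) :
    HasSum (fun m : ℕ ↦ Real.exp (-r) * r ^ m / (m.factorial : ℝ) * ((m : ℝ) - r) ^ 2) r := by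
  have h0 : HasSum (fun m : ℕ ↦ Real.exp (-r) * r ^ m / (m.factorial : ℝ)) 1 := by
    convert! (NormedSpace.expSeries_div_hasSum_exp r).mul_left (Real.exp (-r)) using 1
    · simp_rw [mul_div_assoc]
    · simp [← Real.exp_eq_exp_ℝ, ← Real.exp_add]
  have h1 : HasSum (fun m : ℕ ↦ Real.exp (-r) * r ^ m / (m.factorial : ℝ) * m) r := by
    rw [← hasSum_nat_add_iff' 1]
    convert! h0.mul_left r using 1
    · ext m
      rw [Nat.factorial_succ, Nat.cast_mul, pow_succ]
      field_simp
    · simp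
  have h2 : HasSum (fun m : ℕ ↦ Real.exp (-r) * r ^ m / (m.factorial : ℝ) * (m * (m - 1)))
      (r ^ 2) := by
    rw [← hasSum_nat_add_iff' 1]
    convert! h1.mul_left r using 1
    · ext m
      rw [Nat.factorial_succ, Nat.cast_mul, pow_succ]
      push_cast
      field_simp
      ring
    · simp [sq]
  convert! (h2.add (h1.mul_left (1 - 2 * r))).add (h0.mul_left (r ^ 2)) using 1
  · ext m
    ring
  · ring

/-- For `n ≥ 1`, a `[0,1]`-valued `p : ℕ → ℝ` and
`q := Σ_m Poisson(n/2)(m) p(m)`: if `q > 0` and `n ≥ 36/q`, then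
`Σ_{m=0}^n Binomial(n,1/2)(m) p(m) ≥ (q/4) e^(-3/q)`. -/
theorem binomial_expectation_ge_poisson (n : ℕ) (hn : 1 ≤ n) (p : ℕ → ℝ)
    (hp : ∀ m, p m ∈ Icc (0 : ℝ) 1)
    (q : ℝ)
    (hq : q = ∑' m : ℕ, Real.exp (-(n : ℝ) / 2) * ((n : ℝ) / 2) ^ m / (m.factorial : ℝ) * p m)
    (hqpos : 0 < q) (hnq : 36 / q ≤ (n : ℝ)) :
    q / 4 * Real.exp (-3 / q) ≤
      ∑ m ∈ Finset.range (n + 1), (n.choose m : ℝ) / 2 ^ n * p m := by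
  have hn0 : (0 : ℝ) < n := by exact_mod_cast hn
  have hnq' : 36 ≤ n * q := (div_le_iff₀ hqpos).1 hnq
  have hsum : HasSum (fun m : ℕ ↦ Real.exp (-(n : ℝ) / 2) * ((n : ℝ) / 2) ^ m /
      (m.factorial : ℝ) * p m) q := by
    rw [hq]
    refine Summable.hasSum (by_contra fun h ↦ ?_)
    rw [tsum_eq_zero_of_not_summable h] at hq
    exact hqpos.ne' hq
  have hvar := hasSum_poisson_mul_sub_sq ((n : ℝ) / 2)
  rw [← neg_div] at hvar
  have hbin : HasSum (fun m ↦ (n.choose m : ℝ) / 2 ^ n * p m)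
      (∑ m ∈ Finset.range (n + 1), (n.choose m : ℝ) / 2 ^ n * p m) :=
    hasSum_sum_of_ne_finset_zero fun m hm ↦ by
      rw [Finset.mem_range, not_lt] at hm
      simp [Nat.choose_eq_zero_of_lt hm]
  have hdiff := (hsum.sub (hvar.mul_left (q / n))).mul_left (1 / 2 * Real.exp (-3 / q))
  have hval : 1 / 2 * Real.exp (-3 / q) * (q - q / n * (n / 2)) =
      q / 4 * Real.exp (-3 / q) := by
    field_simp
    ring
  rw [hval] at hdiff
  refine hasSum_le (fun m ↦ ?_) hdiff hbin
  obtain ⟨hp0, hp1⟩ := hp m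
  set P := Real.exp (-(n : ℝ) / 2) * ((n : ℝ) / 2) ^ m / (m.factorial : ℝ) with hP
  have hP0 : 0 ≤ P := by positivity
  set d := ((m : ℝ) - n / 2) ^ 2 with hd
  have hd0 : 0 ≤ d := sq_nonneg _
  have hfac : P * p m - q / n * (P * d) = P * (p m - q / n * d) := by ring
  rw [hfac]
  have hrhs : 0 ≤ (n.choose m : ℝ) / 2 ^ n * p m := by positivity
  by_cases hfar : 1 ≤ q / n * d
  · refine le_trans ?_ hrhs
    exact mul_nonpos_of_nonneg_of_nonpos (by positivity)
      (mul_nonpos_of_nonneg_of_nonpos hP0 (by linarith))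
  · rw [not_le, div_mul_eq_mul_div, div_lt_one hn0] at hfar
    have hmn : m < n := by
      by_contra! hle
      have hle' : (n : ℝ) ≤ m := by exact_mod_cast hle
      have h1 : ((n : ℝ) / 2) ^ 2 ≤ d := pow_le_pow_left₀ (by positivity) (by linarith) 2
      nlinarith [mul_le_mul_of_nonneg_left h1 hqpos.le, mul_le_mul_of_nonneg_left hnq' hn0.le]
    have hexp : Real.exp (-3 / q) ≤ Real.exp (-(2 * d / n)) := by
      rw [Real.exp_le_exp, neg_div, neg_le_neg_iff, div_le_div_iff₀ hn0 hqpos]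
      linarith
    calc 1 / 2 * Real.exp (-3 / q) * (P * (p m - q / n * d))
        ≤ 1 / 2 * Real.exp (-3 / q) * (P * p m) := by
          gcongr
          exact sub_le_self _ (by positivity)
      _ ≤ 1 / 2 * Real.exp (-(2 * d / n)) * (P * p m) := by gcongr
      _ = 1 / 2 * Real.exp (-(2 * d / n)) * P * p m := by ring
      _ ≤ (n.choose m : ℝ) / 2 ^ n * p m := by
          gcongr
          exact poisson_le_choose_div_two_pow hmn
end
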